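/- Let n ≥ 1 and let X ⊆ [0,1]^n be a nonempty closed set such that the rational points of X (points all of whose coordinates are rational) are dense in X. Then the unital ℓ-group (M_n↾X, 1) is hopfian: every surjective unital ℓ-endomorphism of (M_n↾X, 1) is injective. (This is the concrete form of the statement that every finitely generated semisimple unital ℓ-group whose finite rank maximal ideals are dense in its maximal spectral space is hopfian.) -/

import Mathlib

open Set BigOperators

/-- The unit cube `[0,1]^n` as a subset of `Fin n → ℝ`. -/
def cube (n : ℕ) : Set (Fin n → ℝ) := Set.Icc 0 1

/-- An (affine) linear polynomial with integer coefficients. -/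
def IsAffineZ {n : ℕ} (p : (Fin n → ℝ) → ℝ) : Prop :=
  ∃ (m : ℤ) (c : Fin n → ℤ), ∀ x, p x = (m : ℝ) + ∑ i, (c i : ℝ) * x i

/-- An element of `M_n`: a continuous real-valued function on `[0,1]^n` that agrees at each
point of the cube with one of finitely many affine polynomials with integer coefficients. -/
def IsPWLZ {n : ℕ} (f : (Fin n → ℝ) → ℝ) : Prop :=
  ContinuousOn f (cube n) ∧
  ∃ (u : ℕ) (p : Fin u → (Fin n → ℝ) → ℝ),
    (∀ j, IsAffineZ (p j)) ∧ ∀ x ∈ cube n, ∃ j, f x = p j x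

/-- `Mres X = M_n↾X`: restrictions to `X` of elements of `M_n`. -/
def Mres {n : ℕ} (X : Set (Fin n → ℝ)) : Set (↥X → ℝ) :=
  {g : ↥X → ℝ | ∃ f, IsPWLZ (n := n) f ∧ ∀ x : X, g x = f x.1}

/-- A unital ℓ-endomorphism of `(M_n↾X, 1)`: preserves `+`, `⊔`, `⊓` (pointwise) and the
unit (the constant function `1`). -/
def IsUnitalLEndo {n : ℕ} (X : Set (Fin n → ℝ)) (σ : (↥X → ℝ) → (↥X → ℝ)) : Prop :=
  Set.MapsTo σ (Mres X) (Mres X) ∧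
  (∀ f ∈ Mres X, ∀ g ∈ Mres X, σ (f + g) = σ f + σ g) ∧
  (∀ f ∈ Mres X, ∀ g ∈ Mres X, σ (f ⊔ g) = σ f ⊔ σ g) ∧
  (∀ f ∈ Mres X, ∀ g ∈ Mres X, σ (f ⊓ g) = σ f ⊓ σ g) ∧
  σ 1 = 1

/-- A point all of whose coordinates are rational. -/
def IsRationalPoint {n : ℕ} (x : Fin n → ℝ) : Prop := ∀ i, ∃ q : ℚ, x i = (q : ℝ)

section EvaluationFunctional

variable {Y : Type*}

/-- If an additive, sup-preserving, unital functional does not agree with evaluation at `y`, this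
is witnessed by an element on which it is nonpositive and which exceeds `1` at `y`. -/
lemma exists_map_nonpos_one_lt {G : AddSubgroup (Y → ℝ)} (h1 : (1 : Y → ℝ) ∈ G)
    (h : G →+ ℝ) (hone : h ⟨1, h1⟩ = 1) (y : Y) (f : G) (hf : h f < f.1 y) :
    ∃ g : G, h g ≤ 0 ∧ 1 < g.1 y := by
  obtain ⟨N, hN⟩ := exists_nat_gt (2 / (f.1 y - h f))
  rw [div_lt_iff₀ (by linarith)] at hN
  refine ⟨N • f - ⌈(N : ℝ) * h f⌉ • ⟨1, h1⟩, ?_, ?_⟩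
  · have := Int.le_ceil ((N : ℝ) * h f)
    simp only [map_sub, map_nsmul, map_zsmul, hone, nsmul_eq_mul, zsmul_eq_mul]
    linarith
  · have := Int.ceil_lt_add_one ((N : ℝ) * h f)
    have hy : (N • f - ⌈(N : ℝ) * h f⌉ • (⟨1, h1⟩ : G)).1 y =
        N * f.1 y - ⌈(N : ℝ) * h f⌉ := by simp
    linarith

/-- A unital ℓ-homomorphism into `ℝ` from a unital ℓ-group of continuous functions on a compact
space is evaluation at some point. -/
theorem exists_eq_eval [TopologicalSpace Y] [CompactSpace Y] (G : AddSubgroup (Y → ℝ))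
    (hcont : ∀ f ∈ G, Continuous f)
    (hsup : ∀ f ∈ G, ∀ g ∈ G, f ⊔ g ∈ G) (h1 : (1 : Y → ℝ) ∈ G)
    (h : G →+ ℝ) (hone : h ⟨1, h1⟩ = 1)
    (hmap : ∀ f g : G, h ⟨f.1 ⊔ g.1, hsup _ f.2 _ g.2⟩ = h f ⊔ h g) :
    ∃ y, ∀ f : G, h f = f.1 y := by
  by_contra! hcon
  obtain ⟨g, hg0, hg1⟩ : ∃ g : G, h g ≤ 0 ∧ ∀ x ∈ (univ : Set Y), 1 ≤ g.1 x := by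
    refine isCompact_univ.induction_on (p := fun s => ∃ g : G, h g ≤ 0 ∧ ∀ x ∈ s, 1 ≤ g.1 x)
      ⟨0, by simp, by simp⟩ ?_ ?_ ?_
    · rintro s t hst ⟨g, hg, hg'⟩
      exact ⟨g, hg, fun x hx => hg' x (hst hx)⟩
    · rintro s t ⟨f, hf, hf'⟩ ⟨g, hg, hg'⟩
      refine ⟨⟨f.1 ⊔ g.1, hsup _ f.2 _ g.2⟩, ?_, ?_⟩
      · rw [hmap]
        exact sup_le hf hg
      · rintro x (hx | hx)
        · exact (hf' x hx).trans le_sup_left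
        · exact (hg' x hx).trans le_sup_right
    · intro y _
      obtain ⟨g, hg, hgy⟩ : ∃ g : G, h g ≤ 0 ∧ 1 < g.1 y := by
        obtain ⟨f, hf⟩ := hcon y
        rcases lt_or_gt_of_ne hf with hlt | hlt
        · exact exists_map_nonpos_one_lt h1 h hone y f hlt
        · exact exists_map_nonpos_one_lt h1 h hone y (-f) (by simpa using hlt)
      exact ⟨{x | 1 < g.1 x},
        mem_nhdsWithin_of_mem_nhds ((hcont _ g.2).continuousAt.eventually_const_lt hgy),
        g, hg, fun x hx => le_of_lt hx⟩
  have hle : (1 : Y → ℝ) ⊔ g.1 = g.1 := sup_eq_right.2 fun x => hg1 x (mem_univ x)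
  have key := hmap ⟨1, h1⟩ g
  simp only [hle, Subtype.coe_eta, hone] at key
  have : (1 : ℝ) ≤ h g := key ▸ le_sup_left
  linarith

end EvaluationFunctional

section PiecewiseAffine

variable {n : ℕ}

lemma IsPWLZ.of_finite {f : (Fin n → ℝ) → ℝ} {ι : Type*} [Finite ι] (hf : ContinuousOn f (cube n))
    (p : ι → (Fin n → ℝ) → ℝ) (hp : ∀ j, IsAffineZ (p j))
    (hfp : ∀ x ∈ cube n, ∃ j, f x = p j x) : IsPWLZ f := by
  obtain ⟨u, ⟨e⟩⟩ := Finite.exists_equiv_fin ι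
  refine ⟨hf, u, fun j => p (e.symm j), fun j => hp _, fun x hx => ?_⟩
  obtain ⟨j, hj⟩ := hfp x hx
  exact ⟨e j, by simpa using hj⟩

lemma IsAffineZ.isPWLZ {f : (Fin n → ℝ) → ℝ} (hf : IsAffineZ f) : IsPWLZ f := by
  refine .of_finite (ι := Unit) ?_ (fun _ => f) (fun _ => hf) fun x _ => ⟨(), rfl⟩
  obtain ⟨m, c, h⟩ := hf
  rw [funext h]
  fun_prop

lemma isAffineZ_const (m : ℤ) : IsAffineZ (fun _ : Fin n → ℝ => (m : ℝ)) :=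
  ⟨m, 0, by simp⟩

lemma isAffineZ_proj (i : Fin n) : IsAffineZ (fun x : Fin n → ℝ => x i) :=
  ⟨0, Pi.single i 1, by simp [Pi.single_apply]⟩

lemma IsAffineZ.add {f g : (Fin n → ℝ) → ℝ} (hf : IsAffineZ f) (hg : IsAffineZ g) :
    IsAffineZ (f + g) := by
  obtain ⟨m, c, hf⟩ := hf
  obtain ⟨k, d, hg⟩ := hg
  refine ⟨m + k, c + d, fun x => ?_⟩
  simp [hf, hg, add_mul, Finset.sum_add_distrib]
  ring

lemma IsAffineZ.neg {f : (Fin n → ℝ) → ℝ} (hf : IsAffineZ f) : IsAffineZ (-f) := by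
  obtain ⟨m, c, hf⟩ := hf
  refine ⟨-m, -c, fun x => ?_⟩
  simp [hf]
  ring

lemma IsPWLZ.add {f g : (Fin n → ℝ) → ℝ} (hf : IsPWLZ f) (hg : IsPWLZ g) : IsPWLZ (f + g) := by
  obtain ⟨hf, u, p, hp, hfp⟩ := hf
  obtain ⟨hg, v, q, hq, hgq⟩ := hg
  refine .of_finite (ι := Fin u × Fin v) (hf.add hg) (fun j => p j.1 + q j.2)
    (fun j => (hp _).add (hq _)) fun x hx => ?_
  obtain ⟨i, hi⟩ := hfp x hx
  obtain ⟨j, hj⟩ := hgq x hx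
  exact ⟨(i, j), by simp [hi, hj]⟩

lemma IsPWLZ.neg {f : (Fin n → ℝ) → ℝ} (hf : IsPWLZ f) : IsPWLZ (-f) := by
  obtain ⟨hf, u, p, hp, hfp⟩ := hf
  refine ⟨hf.neg, u, fun j => -p j, fun j => (hp j).neg, fun x hx => ?_⟩
  obtain ⟨i, hi⟩ := hfp x hx
  exact ⟨i, by simp [hi]⟩

lemma IsPWLZ.sup {f g : (Fin n → ℝ) → ℝ} (hf : IsPWLZ f) (hg : IsPWLZ g) : IsPWLZ (f ⊔ g) := by
  obtain ⟨hf, u, p, hp, hfp⟩ := hf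
  obtain ⟨hg, v, q, hq, hgq⟩ := hg
  refine .of_finite (ι := Fin u ⊕ Fin v) (hf.sup hg) (Sum.elim p q) ?_ fun x hx => ?_
  · rintro (j | j)
    exacts [hp j, hq j]
  · rcases le_total (f x) (g x) with h | h
    · obtain ⟨j, hj⟩ := hgq x hx
      exact ⟨.inr j, by simp [← hj, h]⟩
    · obtain ⟨j, hj⟩ := hfp x hx
      exact ⟨.inl j, by simp [← hj, h]⟩

/-- The points `x` such that `d • x` has integer coordinates. -/
def latticePoints (n d : ℕ) : Set (Fin n → ℝ) := {x | ∀ i, ∃ k : ℤ, (d : ℝ) * x i = k}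

lemma IsPWLZ.exists_int {f : (Fin n → ℝ) → ℝ} (hf : IsPWLZ f) {d : ℕ} {x : Fin n → ℝ}
    (hx : x ∈ cube n) (hd : x ∈ latticePoints n d) : ∃ k : ℤ, (d : ℝ) * f x = k := by
  obtain ⟨-, u, p, hp, hfp⟩ := hf
  obtain ⟨j, hj⟩ := hfp x hx
  obtain ⟨m, c, h⟩ := hp j
  choose k hk using hd
  refine ⟨d * m + ∑ i, c i * k i, ?_⟩
  rw [hj, h, mul_add, Finset.mul_sum]
  push_cast
  congr 1
  refine Finset.sum_congr rfl fun i _ => ?_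
  rw [← hk]
  ring

lemma finite_cube_inter_latticePoints {d : ℕ} (hd : 0 < d) :
    (cube n ∩ latticePoints n d).Finite := by
  have hd' : (0 : ℝ) < d := by exact_mod_cast hd
  refine ((Set.finite_Icc (0 : Fin n → ℤ) (fun _ => d)).image
    (fun k i => (k i : ℝ) / d)).subset ?_
  rintro x ⟨hx, hk⟩
  choose k hk using hk
  refine ⟨k, ⟨fun i => ?_, fun i => ?_⟩, ?_⟩
  · have : (0 : ℝ) ≤ k i := hk i ▸ mul_nonneg hd'.le (hx.1 i)
    exact_mod_cast this
  · have : (k i : ℝ) ≤ d := hk i ▸ mul_le_of_le_one_right hd'.le (hx.2 i)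
    exact_mod_cast this
  · funext i
    simp only [← hk i]
    field_simp

lemma IsRationalPoint.exists_mem_latticePoints {x : Fin n → ℝ} (hx : IsRationalPoint x) :
    ∃ d : ℕ, 0 < d ∧ x ∈ latticePoints n d := by
  choose q hq using hx
  refine ⟨∏ i, (q i).den, Finset.prod_pos fun i _ => (q i).den_pos, fun i => ?_⟩
  obtain ⟨e, he⟩ := Finset.dvd_prod_of_mem (fun i => (q i).den) (Finset.mem_univ i)
  refine ⟨e * (q i).num, ?_⟩
  have h : ((q i : ℚ) : ℝ) * (q i).den = (q i).num := by exact_mod_cast Rat.mul_den_eq_num (q i)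
  rw [he, hq i]
  push_cast
  rw [← h]
  ring

/-- The subgroup of functions on `X` underlying `Mres X`. -/
def MresAddSubgroup (X : Set (Fin n → ℝ)) : AddSubgroup (↥X → ℝ) where
  carrier := Mres X
  zero_mem' := ⟨fun _ => ((0 : ℤ) : ℝ), (isAffineZ_const 0).isPWLZ, by simp⟩
  add_mem' := by
    rintro f g ⟨f', hf, hff⟩ ⟨g', hg, hgg⟩
    exact ⟨f' + g', hf.add hg, fun x => by simp [hff, hgg]⟩
  neg_mem' := by
    rintro f ⟨f', hf, hff⟩
    exact ⟨-f', hf.neg, fun x => by simp [hff]⟩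

variable {X : Set (Fin n → ℝ)}

lemma one_mem_Mres : (1 : ↥X → ℝ) ∈ Mres X :=
  ⟨fun _ => ((1 : ℤ) : ℝ), (isAffineZ_const 1).isPWLZ, by simp⟩

lemma proj_mem_Mres (i : Fin n) : (fun x : ↥X => x.1 i) ∈ Mres X :=
  ⟨_, (isAffineZ_proj i).isPWLZ, fun _ => rfl⟩

lemma sup_mem_Mres {f g : ↥X → ℝ} (hf : f ∈ Mres X) (hg : g ∈ Mres X) : f ⊔ g ∈ Mres X := by
  obtain ⟨f', hf, hff⟩ := hf
  obtain ⟨g', hg, hgg⟩ := hg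
  exact ⟨f' ⊔ g', hf.sup hg, fun x => by simp [hff, hgg]⟩

lemma continuous_of_mem_Mres (hXc : X ⊆ cube n) {f : ↥X → ℝ} (hf : f ∈ Mres X) :
    Continuous f := by
  obtain ⟨f', hf, hff⟩ := hf
  rw [funext hff]
  exact continuousOn_iff_continuous_domRestrict.1 (hf.1.mono hXc)

/-- A unital ℓ-endomorphism of `Mres X` is composition with a self-map of `X`. -/
theorem IsUnitalLEndo.exists_eq_comp (hXc : X ⊆ cube n) (hcl : IsClosed X)
    {σ : (↥X → ℝ) → (↥X → ℝ)} (hσ : IsUnitalLEndo X σ) :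
    ∃ φ : ↥X → ↥X, ∀ f ∈ Mres X, σ f = f ∘ φ := by
  obtain ⟨-, hadd, hsup, -, hone⟩ := hσ
  have : CompactSpace ↥X := isCompact_iff_compactSpace.1 (isCompact_Icc.of_isClosed_subset hcl hXc)
  have hpt (x : ↥X) : ∃ y : ↥X, ∀ f : MresAddSubgroup X, σ f.1 x = f.1 y :=
    exists_eq_eval (MresAddSubgroup X) (fun f hf => continuous_of_mem_Mres hXc hf)
      (fun f hf g hg => sup_mem_Mres hf hg) one_mem_Mres
      (AddMonoidHom.mk' (fun f => σ f.1 x) fun f g => by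
        simpa using congrFun (hadd _ f.2 _ g.2) x)
      (by simp [hone])
      (fun f g => by simpa using congrFun (hsup _ f.2 _ g.2) x)
  choose φ hφ using hpt
  exact ⟨φ, fun f hf => funext fun x => hφ x ⟨f, hf⟩⟩

end PiecewiseAffine

/-- if `X ⊆ [0,1]^n` is nonempty, closed, and its rational points are dense
in `X`, then the unital ℓ-group `(M_n↾X, 1)` is hopfian: every surjective unital
ℓ-endomorphism is injective. -/
theorem stmt2 {n : ℕ} (hn : 1 ≤ n) (X : Set (Fin n → ℝ)) (hXc : X ⊆ cube n)
    (hcl : IsClosed X) (hne : X.Nonempty)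
    (hdense : X ⊆ closure {x ∈ X | IsRationalPoint x}) :
    ∀ σ : (↥X → ℝ) → (↥X → ℝ), IsUnitalLEndo X σ →
      Set.SurjOn σ (Mres X) (Mres X) → Set.InjOn σ (Mres X) := by
  intro σ hσ hsurj
  obtain ⟨φ, hφ⟩ := hσ.exists_eq_comp hXc hcl
  have hinj : Function.Injective φ := by
    intro x y hxy
    ext i
    obtain ⟨f, hf, hfi⟩ := hsurj (proj_mem_Mres i)
    rw [hφ f hf] at hfi
    have hx := congrFun hfi x
    have hy := congrFun hfi y
    simp only [Function.comp_apply, hxy] at hx hy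
    exact hx.symm.trans hy
  have hrange : ∀ x : ↥X, IsRationalPoint x.1 → x ∈ range φ := by
    intro x hx
    obtain ⟨d, hd, hxd⟩ := hx.exists_mem_latticePoints
    let F : Set ↥X := {y | y.1 ∈ latticePoints n d}
    have hfin : F.Finite := by
      refine Set.Finite.of_finite_image
        ((finite_cube_inter_latticePoints (n := n) hd).subset ?_) Subtype.val_injective.injOn
      rintro _ ⟨y, hy, rfl⟩
      exact ⟨hXc y.2, hy⟩
    have hmaps : MapsTo φ F F := by
      intro y hy i
      obtain ⟨g, hg, hgg⟩ := hσ.1 (proj_mem_Mres i)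
      have hi : (φ y).1 i = g y.1 := by
        rw [← hgg y, hφ _ (proj_mem_Mres i)]
        rfl
      rw [hi]
      exact hg.exists_int (hXc y.2) hy
    obtain ⟨y, -, hy⟩ := (hfin.injOn_iff_bijOn_of_mapsTo hmaps).1 hinj.injOn |>.surjOn hxd
    exact ⟨y, hy⟩
  have hden : Dense {x : ↥X | IsRationalPoint x.1} := by
    intro x
    rw [closure_subtype]
    refine closure_mono ?_ (hdense x.2)
    rintro y ⟨hy, hyr⟩
    exact ⟨⟨y, hy⟩, hyr, rfl⟩
  intro f hf g hg hfg
  rw [hφ f hf, hφ g hg] at hfg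
  refine Continuous.ext_on hden (continuous_of_mem_Mres hXc hf) (continuous_of_mem_Mres hXc hg) ?_
  intro x hx
  obtain ⟨y, rfl⟩ := hrange x hx
  exact congrFun hfg y
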